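/- arXiv:1710.08509 — 2 statements merged into one kernel-verified Lean document; each statement's English description precedes it below -/
import Mathlib

section
/- Let α = α(n) > 0 be the unique positive real satisfying e^{2α²}·α = √n/√(log n), and set r₀ = ⌊n/2 − α√n⌋. Then Σ_{i=0}^{r₀} C(n,i) = Θ((√n/α) · C(n, r₀)); that is, there exist constants c, C > 0 and N such that for all n ≥ N, c · (√n/α) C(n,r₀) ≤ Σ_{i=0}^{r₀} C(n,i) ≤ C · (√n/α) C(n,r₀). -/
lemma bvs_upper (n r : ℕ) (h : 2 * r ≤ n) :
    (∑ i ∈ Finset.range (r + 1), (n.choose i : ℝ)) * ((n : ℝ) - 2 * r + 1) ≤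
      ((n : ℝ) - r + 1) * n.choose r := by
  induction r with
  | zero => simp
  | succ r ih =>
    have ih := ih (by omega)
    rw [Finset.sum_range_succ]
    set S := ∑ i ∈ Finset.range (r + 1), (n.choose i : ℝ) with hS
    have e : (n.choose (r + 1) : ℝ) * (r + 1) = n.choose r * ((n : ℝ) - r) := by
      have := Nat.choose_succ_right_eq n r
      have h2 : ((n - r : ℕ) : ℝ) = (n : ℝ) - r := by
        rw [Nat.cast_sub (by omega)]
      rw [← h2]; exact_mod_cast this
    have hn : 2 * ((r : ℝ) + 1) ≤ n := by exact_mod_cast h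
    have hr : (0 : ℝ) ≤ r := by positivity
    set A := (n.choose r : ℝ)
    set B := (n.choose (r + 1) : ℝ)
    have hB : 0 ≤ B := by positivity
    push_cast
    obtain ⟨b, hb⟩ : ∃ b : ℝ, b = (n : ℝ) - 2 * r := ⟨_, rfl⟩
    have hb2 : 2 ≤ b := by linarith
    have hn' : (n : ℝ) = b + 2 * r := by linarith
    rw [hn'] at ih e ⊢
    have hA : 0 ≤ A := by positivity
    have key : S * (b - 1) ≤ (r + 1) * B := by
      have h1 : S * (b + 1) * (b - 1) ≤ (b + r + 1) * A * (b - 1) := by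
        apply mul_le_mul_of_nonneg_right _ (by linarith)
        nlinarith [ih]
      have h2 : (b + r + 1) * A * (b - 1) ≤ A * (b + r) * (b + 1) := by
        nlinarith [mul_nonneg hA hr]
      have h3 : (S * (b - 1)) * (b + 1) ≤ ((r + 1) * B) * (b + 1) := by
        have : ((r : ℝ) + 1) * B = A * (b + r) := by linarith
        rw [this]; linarith
      exact le_of_mul_le_mul_right h3 (by linarith)
    linarith

lemma bvs_lower (n r m : ℕ) (hm : m ≤ r) (hr : r ≤ n) (j : ℕ) (hj : j ≤ m) :
    (((r : ℝ) - m) / ((n : ℝ) - r + m)) ^ j * n.choose r ≤ n.choose (r - j) := by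
  induction j with
  | zero => simp
  | succ j ih =>
    have ih := ih (by omega)
    obtain ⟨k, hk⟩ : ∃ k, r = k + j + 1 := ⟨r - j - 1, by omega⟩
    have e1 : r - j = k + 1 := by omega
    have e2 : r - (j + 1) = k := by omega
    rw [e1] at ih
    rw [e2]
    have e : (n.choose (k + 1) : ℝ) * (k + 1) = n.choose k * ((n : ℝ) - k) := by
      have := Nat.choose_succ_right_eq n k
      have h2 : ((n - k : ℕ) : ℝ) = (n : ℝ) - k := by
        rw [Nat.cast_sub (by omega)]
      rw [← h2]; exact_mod_cast this
    have hrk : (r : ℝ) = k + j + 1 := by exact_mod_cast hk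
    have hjm : (j : ℝ) + 1 ≤ m := by exact_mod_cast hj
    have hmr : (m : ℝ) ≤ r := by exact_mod_cast hm
    have hrn : (r : ℝ) ≤ n := by exact_mod_cast hr
    have hj0 : (0 : ℝ) ≤ j := by positivity
    have hq : 0 ≤ ((r : ℝ) - m) / ((n : ℝ) - r + m) :=
      div_nonneg (by linarith) (by linarith)
    have hnk : 0 < (n : ℝ) - k := by linarith
    have hq2 : ((r : ℝ) - m) / ((n : ℝ) - r + m) ≤ (k + 1) / (n - k) := by
      apply div_le_div₀ <;> linarith
    have : (n.choose k : ℝ) = (k + 1) / (n - k) * n.choose (k + 1) := by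
      field_simp; linarith
    rw [this, pow_succ']
    rw [mul_assoc]
    exact mul_le_mul hq2 ih (by positivity) (hq.trans hq2)

lemma bvs_range (n : ℕ) (hn : 1000000 ≤ n) (α : ℝ) (hα : 0 < α)
    (h : Real.exp (2 * α ^ 2) * α = Real.sqrt n / Real.sqrt (Real.log n)) :
    1 ≤ α ∧ α ≤ Real.sqrt n / 8 := by
  have hn' : (1000000 : ℝ) ≤ n := by exact_mod_cast hn
  have hn0 : (0 : ℝ) < n := by linarith
  set s := Real.sqrt n with hs
  have hss : s ^ 2 = n := Real.sq_sqrt hn0.le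
  have hs1 : 1000 ≤ s := Real.le_sqrt_of_sq_le (by linarith)
  have hlog : Real.log n ≤ 2 * s := by
    rw [← hss, Real.log_pow]
    have := Real.log_le_sub_one_of_pos (show 0 < s by linarith)
    push_cast; linarith
  have hlog1 : 1 ≤ Real.log n := by
    rw [Real.le_log_iff_exp_le hn0]
    have := Real.exp_one_lt_d9
    linarith
  set L := Real.sqrt (Real.log n) with hL
  have hLL : L ^ 2 = Real.log n := Real.sq_sqrt (by linarith)
  have hL1 : 1 ≤ L := Real.le_sqrt_of_sq_le (by linarith)
  rw [eq_div_iff (by linarith)] at h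
  have h1 : 1 ≤ α := by
    by_contra hc
    push Not at hc
    have hE : Real.exp (2 * α ^ 2) ≤ 9 := by
      have : Real.exp (2 * α ^ 2) ≤ Real.exp (1 + 1) := Real.exp_le_exp.2 (by nlinarith)
      rw [Real.exp_add] at this
      have h2 := Real.exp_one_lt_d9
      have h3 := Real.exp_pos 1
      nlinarith
    have hEp := Real.exp_pos (2 * α ^ 2)
    have : Real.exp (2 * α ^ 2) * α ≤ 9 := by nlinarith
    have : s ≤ 9 * L := by rw [← h]; exact mul_le_mul_of_nonneg_right this (by linarith)
    nlinarith
  refine ⟨h1, ?_⟩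
  by_contra hc
  push Not at hc
  have hE : 2 * α ^ 2 ≤ Real.exp (2 * α ^ 2) := by
    have := Real.add_one_le_exp (2 * α ^ 2); linarith
  have h2 : 2 * α ^ 2 * α ≤ s := by
    calc 2 * α ^ 2 * α ≤ Real.exp (2 * α ^ 2) * α := mul_le_mul_of_nonneg_right hE hα.le
      _ ≤ Real.exp (2 * α ^ 2) * α * L := le_mul_of_one_le_right (by positivity) hL1
      _ = s := h
  have h3 : 2 * α ^ 2 * α ≤ 8 * α := by linarith
  have h4 : 2 * α ^ 2 ≤ 8 := le_of_mul_le_mul_right h3 hα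
  nlinarith


/-- With `α = α(n) > 0` the unique positive real satisfying
`e^{2α²}·α = √n/√(log n)` and `r₀ = ⌊n/2 − α√n⌋`, one has
`∑_{i=0}^{r₀} C(n,i) = Θ((√n/α) · C(n, r₀))`. -/
theorem ball_vs_sphere_asymptotics :
    ∃ c C : ℝ, 0 < c ∧ 0 < C ∧ ∃ N : ℕ, ∀ n : ℕ, N ≤ n → ∀ α : ℝ, 0 < α →
      Real.exp (2 * α ^ 2) * α = Real.sqrt n / Real.sqrt (Real.log n) →
      c * (Real.sqrt n / α) * (n.choose ⌊(n : ℝ) / 2 - α * Real.sqrt n⌋₊ : ℝ) ≤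
        (∑ i ∈ Finset.range (⌊(n : ℝ) / 2 - α * Real.sqrt n⌋₊ + 1), n.choose i : ℝ) ∧
      (∑ i ∈ Finset.range (⌊(n : ℝ) / 2 - α * Real.sqrt n⌋₊ + 1), n.choose i : ℝ) ≤
        C * (Real.sqrt n / α) * (n.choose ⌊(n : ℝ) / 2 - α * Real.sqrt n⌋₊ : ℝ) := by
  refine ⟨1 / 32, 1, by norm_num, by norm_num, 1000000, ?_⟩
  intro n hn α hα h
  obtain ⟨h1, h2⟩ := bvs_range n hn α hα h
  clear h
  have hn' : (1000000 : ℝ) ≤ n := by exact_mod_cast hn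
  have hn0 : (0 : ℝ) < n := by linarith
  set s := Real.sqrt n with hs
  have hss : s ^ 2 = n := Real.sq_sqrt hn0.le
  have hs1 : 1000 ≤ s := Real.le_sqrt_of_sq_le (by linarith)
  have hαs : α * s ≤ n / 8 := by nlinarith
  have hαs0 : 0 < α * s := by positivity
  set r := ⌊(n : ℝ) / 2 - α * s⌋₊ with hr
  have hr1 : (r : ℝ) ≤ n / 2 - α * s := Nat.floor_le (by linarith)
  have hr2 : (n : ℝ) / 2 - α * s < r + 1 := Nat.lt_floor_add_one _
  clear_value r
  have h2r : 2 * r ≤ n := by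
    have : 2 * (r : ℝ) ≤ n := by linarith
    exact_mod_cast this
  have hr0 : (0 : ℝ) ≤ r := by positivity
  have hC : (0 : ℝ) ≤ n.choose r := by positivity
  constructor
  · obtain ⟨m, hm⟩ : ∃ m : ℕ, m = ⌊s / (16 * α)⌋₊ := ⟨_, rfl⟩
    have hm1 : (m : ℝ) ≤ s / (16 * α) := by rw [hm]; exact Nat.floor_le (by positivity)
    have hm2 : s / (16 * α) < m + 1 := by rw [hm]; exact Nat.lt_floor_add_one _
    have hm0 : (0 : ℝ) ≤ m := by positivity
    have hmα : m * α ≤ s / 16 := by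
      rw [le_div_iff₀ (by positivity)] at hm1; linarith
    have hms : (m : ℝ) ≤ s / 16 := by nlinarith
    have hmr : m ≤ r := by
      have : (m : ℝ) ≤ r := by nlinarith
      exact_mod_cast this
    have hmr' : (m : ℝ) ≤ r := by exact_mod_cast hmr
    have hD : 0 < (n : ℝ) - r + m := by linarith
    set q := ((r : ℝ) - m) / ((n : ℝ) - r + m) with hq
    have hq0 : 0 ≤ q := div_nonneg (by linarith) hD.le
    have hq1 : q ≤ 1 := by rw [hq, div_le_one hD]; linarith
    have hqm : 1 / 2 ≤ q ^ m := by
      have hb := one_add_mul_le_pow (a := q - 1) (by linarith) m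
      have : m * (1 - q) ≤ 1 / 2 := by
        have : 1 - q = ((n : ℝ) - 2 * r + 2 * m) / ((n : ℝ) - r + m) := by
          rw [hq]; field_simp; ring
        rw [this, ← mul_div_assoc, div_le_iff₀ hD]
        have a1 : m * ((n : ℝ) - 2 * r + 2 * m) ≤ m * (2 * (α * s) + 2 + 2 * m) :=
          mul_le_mul_of_nonneg_left (by linarith) hm0
        have a2 : m * α * s ≤ s / 16 * s := mul_le_mul_of_nonneg_right hmα (by linarith)
        have a3 : (m : ℝ) * m ≤ s / 16 * (s / 16) := by gcongr
        nlinarith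
      have e : (1 : ℝ) + (q - 1) = q := by ring
      rw [e] at hb
      linarith
    have hterm : ∀ j ∈ Finset.range (m + 1), 1 / 2 * (n.choose r : ℝ) ≤ n.choose (r - j) := by
      intro j hj
      have hj : j ≤ m := by simpa [Nat.lt_succ_iff] using hj
      refine le_trans ?_ (bvs_lower n r m hmr (by omega) j hj)
      exact mul_le_mul_of_nonneg_right (hqm.trans (pow_le_pow_of_le_one hq0 hq1 hj)) hC
    rw [← Finset.sum_range_reflect]
    have hsum : ∑ j ∈ Finset.range (m + 1), (1 / 2 * (n.choose r : ℝ)) ≤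
        ∑ j ∈ Finset.range (r + 1), (n.choose (r + 1 - 1 - j) : ℝ) := by
      refine (Finset.sum_le_sum hterm).trans ?_
      simp only [Nat.add_sub_cancel]
      apply Finset.sum_le_sum_of_subset_of_nonneg
      · intro x; simp; omega
      · intros; positivity
    refine le_trans ?_ hsum
    rw [Finset.sum_const, Finset.card_range, nsmul_eq_mul]
    push_cast
    have : 1 / 32 * (s / α) ≤ (m + 1) * (1 / 2) := by
      have : s / (16 * α) = s / α / 16 := by field_simp
      linarith
    nlinarith
  · have hu := bvs_upper n r h2r
    have hpos : 0 < (n : ℝ) - 2 * r + 1 := by linarith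
    rw [← le_div_iff₀ hpos] at hu
    refine hu.trans ?_
    rw [div_le_iff₀ hpos]
    have : (n : ℝ) - r + 1 ≤ 1 * (s / α) * ((n : ℝ) - 2 * r + 1) := by
      have a : s / α * (2 * (α * s)) = 2 * n := by rw [← hss]; field_simp
      have b : s / α * (2 * (α * s)) ≤ s / α * ((n : ℝ) - 2 * r + 1) :=
        mul_le_mul_of_nonneg_left (by linarith) (by positivity)
      linarith
    nlinarith
end

section
/- Let k = k(n) be a sequence of positive integers with k(n) = n^{o(1)}, i.e. log k(n)/log n → 0 as n → ∞. Then ExVC(n,k) ≤ n^{(1+o(1))·C(n,k)}; that is, for every ε > 0 there exists N such that for all n ≥ N, the number of extremal families in the power set of [n] with VC dimension at most k(n) is at most n^{(1+ε)·C(n,k(n))}. -/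
/-- `F` shatters `S` if every subset of `S` is the trace of a member of `F` on `S`. -/
def Shatters {n : ℕ} (F : Finset (Finset (Fin n))) (S : Finset (Fin n)) : Prop :=
  ∀ A ⊆ S, ∃ B ∈ F, B ∩ S = A

/-- The VC dimension of `F`: the maximum size of a set shattered by `F`. -/
noncomputable def vcDim {n : ℕ} (F : Finset (Finset (Fin n))) : ℕ :=
  sSup {d : ℕ | ∃ S : Finset (Fin n), Shatters F S ∧ S.card = d}

/-- A family is maximal if its size attains the Sauer–Shelah bound for its VC dimension. -/
def IsMaximal {n : ℕ} (F : Finset (Finset (Fin n))) : Prop :=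
  F.card = ∑ i ∈ Finset.range (vcDim F + 1), n.choose i

/-- `m(n,k)`: the number of maximal families in the power set of `[n]` of VC dimension
exactly `k`. -/
noncomputable def maxFamCount (n k : ℕ) : ℕ :=
  Nat.card {F : Finset (Finset (Fin n)) // IsMaximal F ∧ vcDim F = k}

/-- `ExVC(n,k)`: the number of shattering-extremal families (families `F` with
`|Sh(F)| = |F|`) in the power set of `[n]` with VC dimension at most `k`. -/
noncomputable def exVC (n k : ℕ) : ℕ :=
  Nat.card {F : Finset (Finset (Fin n)) //
    Nat.card {S : Finset (Fin n) // Shatters F S} = F.card ∧ vcDim F ≤ k}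

section Conn

variable {α : Type*} [Fintype α] [DecidableEq α]

/-- Connectedness of a vertex set with respect to a neighbourhood map. -/
def ConnSet (nb : α → Finset α) (F : Finset α) : Prop :=
  ∀ G ⊆ F, G.Nonempty → (∀ a ∈ G, ∀ b ∈ F, b ∈ nb a → b ∈ G) → G = F

/-- Outer vertex boundary. -/
def outerBd (nb : α → Finset α) (F : Finset α) : Finset α := F.biUnion nb \ F

/-- Vertex sets containing `F` and avoiding its boundary. -/
def percClass (nb : α → Finset α) (F : Finset α) : Finset (Finset α) :=
  Finset.univ.filter fun W => F ⊆ W ∧ Disjoint W (outerBd nb F)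

lemma percClass_weight (nb : α → Finset α) (F : Finset α) (p : ℝ) (hp0 : 0 ≤ p) (hp1 : p ≤ 1) :
    p ^ F.card * (1 - p) ^ (outerBd nb F).card ≤
      ∑ W ∈ percClass nb F, p ^ W.card * (1 - p) ^ (Fintype.card α - W.card) := by
  set D := outerBd nb F with hD
  have hFD : Disjoint F D := Finset.disjoint_sdiff
  set R : Finset α := (F ∪ D)ᶜ with hR
  have hRF : Disjoint F R := by
    rw [hR]; exact Finset.disjoint_left.2 fun a ha hb => by simp [ha] at hb
  have hcard : F.card + D.card + R.card = Fintype.card α := by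
    rw [← Finset.card_union_of_disjoint hFD, hR, Finset.card_add_card_compl]
  have hinj : Set.InjOn (fun X => F ∪ X) (R.powerset : Set (Finset α)) := by
    intro X hX Y hY h
    have hX' : X ⊆ R := by simpa using hX
    have hY' : Y ⊆ R := by simpa using hY
    have e : ∀ Z ⊆ R, (F ∪ Z) \ F = Z := by
      intro Z hZ
      rw [Finset.union_sdiff_left]
      exact Finset.sdiff_eq_self_of_disjoint (Finset.disjoint_of_subset_left hZ hRF.symm)
    rw [← e X hX', ← e Y hY']
    exact congrArg (· \ F) h
  have hsub : R.powerset.image (fun X => F ∪ X) ⊆ percClass nb F := by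
    intro W hW
    simp only [Finset.mem_image, Finset.mem_powerset] at hW
    obtain ⟨X, hX, rfl⟩ := hW
    simp only [percClass, Finset.mem_filter, Finset.mem_univ, true_and]
    refine ⟨Finset.subset_union_left, ?_⟩
    rw [Finset.disjoint_union_left]
    refine ⟨hFD, Finset.disjoint_left.2 fun a ha hb => ?_⟩
    have := hX ha
    rw [hR] at this
    simp at this
    exact this.2 hb
  have h1p : 0 ≤ 1 - p := by linarith
  calc p ^ F.card * (1 - p) ^ D.card
      = ∑ X ∈ R.powerset, p ^ (F ∪ X).card * (1 - p) ^ (Fintype.card α - (F ∪ X).card) := by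
        have : ∀ X ∈ R.powerset, p ^ (F ∪ X).card * (1 - p) ^ (Fintype.card α - (F ∪ X).card)
            = (p ^ F.card * (1 - p) ^ D.card) * (p ^ X.card * (1 - p) ^ (R.card - X.card)) := by
          intro X hX
          have hX' : X ⊆ R := by simpa using hX
          have h1 := Finset.card_le_card hX'
          rw [Finset.card_union_of_disjoint (Finset.disjoint_of_subset_right hX' hRF)]
          have : Fintype.card α - (F.card + X.card) = D.card + (R.card - X.card) := by omega
          rw [this, pow_add, pow_add]; ring
        rw [Finset.sum_congr rfl this, ← Finset.mul_sum, Finset.sum_pow_mul_eq_add_pow]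
        simp
    _ = ∑ W ∈ R.powerset.image (fun X => F ∪ X),
          p ^ W.card * (1 - p) ^ (Fintype.card α - W.card) := by
        rw [Finset.sum_image hinj]
    _ ≤ _ := Finset.sum_le_sum_of_subset_of_nonneg hsub fun _ _ _ => by positivity

lemma percClass_subset (nb : α → Finset α) {F G W : Finset α} {v : α} (hvF : v ∈ F) (hvG : v ∈ G)
    (hG : ConnSet nb G) (h1 : W ∈ percClass nb F) (h2 : W ∈ percClass nb G) : G ⊆ F := by
  simp only [percClass, Finset.mem_filter, Finset.mem_univ, true_and] at h1 h2
  have := hG (G ∩ F) Finset.inter_subset_left ⟨v, by simp [hvF, hvG]⟩ (by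
    intro a ha b hb hab
    simp only [Finset.mem_inter] at ha ⊢
    refine ⟨hb, ?_⟩
    by_contra hbF
    have : b ∈ outerBd nb F := by
      simp only [outerBd, Finset.mem_sdiff, Finset.mem_biUnion]
      exact ⟨⟨a, ha.2, hab⟩, hbF⟩
    exact Finset.disjoint_left.1 h1.2 (h2.1 hb) this)
  exact Finset.inter_eq_left.1 this

lemma count_conn (nb : α → Finset α) (d m : ℕ) (hd : ∀ a, (nb a).card ≤ d) (v : α)
    (C : Finset (Finset α)) (hC : ∀ F ∈ C, v ∈ F ∧ ConnSet nb F ∧ F.card ≤ m)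
    (p : ℝ) (hp0 : 0 ≤ p) (hp1 : p ≤ 1) :
    (C.card : ℝ) * (p * (1 - p) ^ d) ^ m ≤ 1 := by
  have h1p : 0 ≤ 1 - p := by linarith
  have h1p' : 1 - p ≤ 1 := by linarith
  have hdisj : (C : Set (Finset α)).PairwiseDisjoint (percClass nb) := by
    intro F hF G hG hne
    refine Finset.disjoint_left.2 fun W h1 h2 => hne ?_
    obtain ⟨a1, a2, -⟩ := hC F hF
    obtain ⟨b1, b2, -⟩ := hC G hG
    exact Finset.Subset.antisymm (percClass_subset nb b1 a1 a2 h2 h1)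
      (percClass_subset nb a1 b1 b2 h1 h2)
  have hq : p * (1 - p) ^ d ≤ 1 := mul_le_one₀ hp1 (by positivity) (pow_le_one₀ h1p h1p')
  calc (C.card : ℝ) * (p * (1 - p) ^ d) ^ m = ∑ F ∈ C, (p * (1 - p) ^ d) ^ m := by simp
    _ ≤ ∑ F ∈ C, ∑ W ∈ percClass nb F, p ^ W.card * (1 - p) ^ (Fintype.card α - W.card) := by
        refine Finset.sum_le_sum fun F hF => ?_
        refine le_trans ?_ (percClass_weight nb F p hp0 hp1)
        have hb : (outerBd nb F).card ≤ d * F.card := by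
          refine (Finset.card_le_card Finset.sdiff_subset).trans ?_
          rw [mul_comm]
          exact Finset.card_biUnion_le_card_mul _ _ _ fun a _ => hd a
        calc (p * (1 - p) ^ d) ^ m ≤ (p * (1 - p) ^ d) ^ F.card :=
              pow_le_pow_of_le_one (by positivity) hq (hC F hF).2.2
          _ = p ^ F.card * (1 - p) ^ (d * F.card) := by rw [mul_pow, ← pow_mul]
          _ ≤ _ := by
              gcongr ?_ * ?_
              exact pow_le_pow_of_le_one h1p h1p' hb
    _ = ∑ W ∈ C.biUnion (percClass nb), p ^ W.card * (1 - p) ^ (Fintype.card α - W.card) :=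
        (Finset.sum_biUnion hdisj).symm
    _ ≤ ∑ W ∈ (Finset.univ : Finset α).powerset,
          p ^ W.card * (1 - p) ^ ((Finset.univ : Finset α).card - W.card) := by
        rw [Finset.card_univ]
        refine Finset.sum_le_sum_of_subset_of_nonneg (fun W _ => by simp) fun _ _ _ => by positivity
    _ = 1 := by rw [Finset.sum_pow_mul_eq_add_pow]; simp

end Conn

section Extremal

variable {α : Type*} [DecidableEq α]

lemma shatterer_mono' {F G : Finset (Finset α)} (h : F ⊆ G) : F.shatterer ⊆ G.shatterer :=
  Finset.shatterer_mono h

lemma not_mem_of_shatters_side {F : Finset (Finset α)} {S : Finset α} {x : α}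
    (h : (∀ B ∈ F, x ∉ B) ∨ (∀ B ∈ F, x ∈ B)) (hS : F.Shatters S) : x ∉ S := by
  intro hx
  rcases h with h | h
  · obtain ⟨B, hB, hBS⟩ := hS (Finset.Subset.refl S)
    have : x ∈ S ∩ B := by rw [hBS]; exact hx
    exact h B hB (Finset.mem_inter.1 this).2
  · obtain ⟨B, hB, hBS⟩ := hS (Finset.empty_subset S)
    have : x ∈ S ∩ B := Finset.mem_inter.2 ⟨hx, h B hB⟩
    rw [hBS] at this
    simp at this

lemma card_shatterer_split (F : Finset (Finset α)) (x : α) :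
    (F.filter (x ∉ ·)).shatterer.card + (F.filter (x ∈ ·)).shatterer.card ≤
      F.shatterer.card := by
  set F0 := F.filter (x ∉ ·) with h0
  set F1 := F.filter (x ∈ ·) with h1
  have n0 : ∀ S ∈ F0.shatterer, x ∉ S := fun S hS =>
    not_mem_of_shatters_side (F := F0) (Or.inl fun B hB => (Finset.mem_filter.1 hB).2)
      (Finset.mem_shatterer.1 hS)
  have n1 : ∀ S ∈ F1.shatterer, x ∉ S := fun S hS =>
    not_mem_of_shatters_side (F := F1) (Or.inr fun B hB => (Finset.mem_filter.1 hB).2)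
      (Finset.mem_shatterer.1 hS)
  rw [← Finset.card_union_add_card_inter]
  have hinj : Set.InjOn (insert x) ((F0.shatterer ∩ F1.shatterer : Finset (Finset α)) :
      Set (Finset α)) := by
    intro S hS T hT h
    simp only [Finset.coe_inter, Set.mem_inter_iff, Finset.mem_coe] at hS hT
    rw [← Finset.erase_insert (n0 S hS.1), ← Finset.erase_insert (n0 T hT.1), h]
  rw [← Finset.card_image_of_injOn hinj, ← Finset.card_union_of_disjoint]
  · refine Finset.card_le_card (Finset.union_subset (Finset.union_subset ?_ ?_) ?_)
    · exact Finset.shatterer_mono (Finset.filter_subset _ _)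
    · exact Finset.shatterer_mono (Finset.filter_subset _ _)
    · intro T hT
      simp only [Finset.mem_image, Finset.mem_inter] at hT
      obtain ⟨S, ⟨hS0, hS1⟩, rfl⟩ := hT
      have hx := n0 S hS0
      rw [Finset.mem_shatterer] at hS0 hS1 ⊢
      intro A hA
      have hA' : A.erase x ⊆ S := by rwa [← Finset.subset_insert_iff]
      by_cases hxA : x ∈ A
      · obtain ⟨B, hB, hBS⟩ := hS1 hA'
        rw [h1, Finset.mem_filter] at hB
        refine ⟨B, hB.1, ?_⟩
        rw [Finset.insert_inter_of_mem hB.2, hBS, Finset.insert_erase hxA]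
      · obtain ⟨B, hB, hBS⟩ := hS0 hA'
        rw [h0, Finset.mem_filter] at hB
        refine ⟨B, hB.1, ?_⟩
        rw [Finset.insert_inter_of_notMem hB.2, hBS, Finset.erase_eq_of_notMem hxA]
  · refine Finset.disjoint_left.2 fun T hT hT' => ?_
    simp only [Finset.mem_image] at hT'
    obtain ⟨S, -, rfl⟩ := hT'
    rcases Finset.mem_union.1 hT with h | h
    · exact n0 _ h (Finset.mem_insert_self _ _)
    · exact n1 _ h (Finset.mem_insert_self _ _)

lemma exists_edge (F : Finset (Finset α)) (hF : F.shatterer.card = F.card) (x : α)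
    (h0 : ∃ B ∈ F, x ∉ B) (h1 : ∃ B ∈ F, x ∈ B) : ∃ B ∈ F, x ∉ B ∧ insert x B ∈ F := by
  by_contra hcon
  push Not at hcon
  have hinj : Set.InjOn (fun B => B.erase x) (F : Set (Finset α)) := by
    intro A hA B hB h
    have h : A.erase x = B.erase x := h
    by_cases ha : x ∈ A <;> by_cases hb : x ∈ B
    · rw [← Finset.insert_erase ha, ← Finset.insert_erase hb, h]
    · exfalso
      rw [Finset.erase_eq_of_notMem hb] at h
      refine hcon B hB hb ?_
      rw [← h, Finset.insert_erase ha]; exact hA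
    · exfalso
      rw [Finset.erase_eq_of_notMem ha] at h
      refine hcon A hA ha ?_
      rw [h, Finset.insert_erase hb]; exact hB
    · rwa [Finset.erase_eq_of_notMem ha, Finset.erase_eq_of_notMem hb] at h
  set F' := F.image (fun B => B.erase x) with hF'
  have hc : F'.card = F.card := Finset.card_image_of_injOn hinj
  have hx' : ∀ S, F'.Shatters S → x ∉ S := fun S hS =>
    not_mem_of_shatters_side (F := F') (Or.inl fun B hB => by
      obtain ⟨A, -, rfl⟩ := Finset.mem_image.1 hB
      simp) hS
  have hlt : F'.shatterer ⊂ F.shatterer := by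
    rw [Finset.ssubset_iff_of_subset]
    · refine ⟨{x}, ?_, ?_⟩
      · rw [Finset.mem_shatterer]
        intro A hA
        rcases Finset.subset_singleton_iff.1 hA with rfl | rfl
        · obtain ⟨B, hB, hb⟩ := h0
          exact ⟨B, hB, Finset.singleton_inter_of_notMem hb⟩
        · obtain ⟨B, hB, hb⟩ := h1
          exact ⟨B, hB, Finset.singleton_inter_of_mem hb⟩
      · rw [Finset.mem_shatterer]
        intro h
        exact hx' _ h (Finset.mem_singleton_self x)
    · intro S hS
      rw [Finset.mem_shatterer] at hS ⊢
      have hxS := hx' S hS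
      intro A hA
      obtain ⟨B, hB, hBS⟩ := hS hA
      obtain ⟨B, hB', rfl⟩ := Finset.mem_image.1 hB
      refine ⟨B, hB', ?_⟩
      rw [← hBS]
      ext y
      simp only [Finset.mem_inter, Finset.mem_erase]
      constructor
      · rintro ⟨h1, h2⟩
        exact ⟨h1, fun h => hxS (h ▸ h1), h2⟩
      · rintro ⟨h1, h2, h3⟩
        exact ⟨h1, h3⟩
  have := Finset.card_lt_card hlt
  have := Finset.card_le_card_shatterer F'
  omega

/-- Hypercube neighbourhoods. -/
def cubeNb [Fintype α] (B : Finset α) : Finset (Finset α) :=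
  Finset.univ.image fun x => symmDiff B {x}

lemma insert_mem_cubeNb [Fintype α] {B : Finset α} {x : α} (h : x ∉ B) :
    insert x B ∈ cubeNb B ∧ B ∈ cubeNb (insert x B) := by
  simp only [cubeNb, Finset.mem_image, Finset.mem_univ, true_and]
  refine ⟨⟨x, ?_⟩, ⟨x, ?_⟩⟩ <;>
  · ext y
    simp only [Finset.mem_symmDiff, Finset.mem_singleton, Finset.mem_insert]
    by_cases hy : y = x
    · subst hy; simp [h]
    · simp [hy]

lemma extremal_conn [Fintype α] : ∀ (m : ℕ) (F : Finset (Finset α)), F.card = m →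
    F.shatterer.card = F.card → ConnSet cubeNb F := by
  intro m
  induction m using Nat.strong_induction_on with
  | _ m ih =>
  intro F hm hF G hGF hG hcl
  by_contra hne
  obtain ⟨a, ha⟩ := hG
  obtain ⟨b, hb, hbG⟩ : ∃ b ∈ F, b ∉ G := by
    by_contra h
    push Not at h
    exact hne (Finset.Subset.antisymm hGF h)
  have hab : a ≠ b := fun h => hbG (h ▸ ha)
  obtain ⟨x, hx0, hx1⟩ : ∃ x, (∃ B ∈ F, x ∉ B) ∧ (∃ B ∈ F, x ∈ B) := by
    by_contra hcon
    push Not at hcon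
    apply hab
    ext y
    constructor
    · intro hy
      by_contra hyb
      exact hcon y ⟨b, hb, hyb⟩ a (hGF ha) hy
    · intro hy
      by_contra hya
      exact hcon y ⟨a, hGF ha, hya⟩ b hb hy
  have hsum := Finset.card_filter_add_card_filter_not (s := F) (fun B => x ∈ B)
  have hspl := card_shatterer_split F x
  have hl0 := Finset.card_le_card_shatterer (F.filter (x ∉ ·))
  have hl1 := Finset.card_le_card_shatterer (F.filter (x ∈ ·))
  have p0 : 0 < (F.filter (x ∉ ·)).card := by
    obtain ⟨B, hB, h⟩ := hx0
    exact Finset.card_pos.2 ⟨B, Finset.mem_filter.2 ⟨hB, h⟩⟩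
  have p1 : 0 < (F.filter (x ∈ ·)).card := by
    obtain ⟨B, hB, h⟩ := hx1
    exact Finset.card_pos.2 ⟨B, Finset.mem_filter.2 ⟨hB, h⟩⟩
  have c0 := ih (F.filter (x ∉ ·)).card (by omega) _ rfl (by omega)
  have c1 := ih (F.filter (x ∈ ·)).card (by omega) _ rfl (by omega)
  -- each side is contained in `G` once it meets `G`
  have key : ∀ K ⊆ F, ConnSet cubeNb K → (∃ B ∈ K, B ∈ G) → K ⊆ G := by
    intro K hK hc ⟨B, hB, hBG⟩
    have := hc (K ∩ G) Finset.inter_subset_left ⟨B, by simp [hB, hBG]⟩ (by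
      intro a ha b hb hab
      rw [Finset.mem_inter] at ha ⊢
      exact ⟨hb, hcl a ha.2 b (hK hb) hab⟩)
    exact Finset.inter_eq_left.1 this
  have k0 := key _ (Finset.filter_subset _ _) c0
  have k1 := key _ (Finset.filter_subset _ _) c1
  obtain ⟨B, hB, hxB, hB'⟩ := exists_edge F hF x hx0 hx1
  obtain ⟨e1, e2⟩ := insert_mem_cubeNb hxB
  have m0 : B ∈ F.filter (x ∉ ·) := Finset.mem_filter.2 ⟨hB, hxB⟩
  have m1 : insert x B ∈ F.filter (x ∈ ·) :=
    Finset.mem_filter.2 ⟨hB', Finset.mem_insert_self _ _⟩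
  have both : F.filter (x ∉ ·) ⊆ G ∧ F.filter (x ∈ ·) ⊆ G := by
    by_cases hxa : x ∈ a
    · have h1 := k1 ⟨a, Finset.mem_filter.2 ⟨hGF ha, hxa⟩, ha⟩
      exact ⟨k0 ⟨B, m0, hcl _ (h1 m1) _ hB e2⟩, h1⟩
    · have h0 := k0 ⟨a, Finset.mem_filter.2 ⟨hGF ha, hxa⟩, ha⟩
      exact ⟨h0, k1 ⟨_, m1, hcl _ (h0 m0) _ hB' e1⟩⟩
  by_cases hxb : x ∈ b
  · exact hbG (both.2 (Finset.mem_filter.2 ⟨hb, hxb⟩))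
  · exact hbG (both.1 (Finset.mem_filter.2 ⟨hb, hxb⟩))

end Extremal

lemma shatters_iff {n : ℕ} (F : Finset (Finset (Fin n))) (S : Finset (Fin n)) :
    Shatters F S ↔ F.Shatters S := by
  unfold Shatters Finset.Shatters
  constructor
  · intro h A hA
    obtain ⟨B, hB, e⟩ := h A hA
    exact ⟨B, hB, by rw [Finset.inter_comm]; exact e⟩
  · intro h A hA
    obtain ⟨B, hB, e⟩ := h hA
    exact ⟨B, hB, by rw [Finset.inter_comm]; exact e⟩

lemma card_sh {n : ℕ} (F : Finset (Finset (Fin n))) :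
    Nat.card {S : Finset (Fin n) // Shatters F S} = F.shatterer.card := by
  have : {S : Finset (Fin n) | Shatters F S} = (F.shatterer : Set (Finset (Fin n))) := by
    ext S
    simp [shatters_iff, Finset.mem_shatterer]
  change Nat.card ({S : Finset (Fin n) | Shatters F S} : Set _) = _
  rw [this]
  exact (Nat.card_coe_set_eq _).trans (Set.ncard_coe_finset _)

lemma card_le_of_vcDim {n k : ℕ} (F : Finset (Finset (Fin n))) (h : vcDim F ≤ k) :
    F.shatterer.card ≤ ∑ i ∈ Finset.range (k + 1), n.choose i := by
  have hsub : F.shatterer ⊆ (Finset.range (k + 1)).biUnion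
      fun i => Finset.powersetCard i (Finset.univ : Finset (Fin n)) := by
    intro S hS
    simp only [Finset.mem_biUnion, Finset.mem_range, Finset.mem_powersetCard]
    refine ⟨S.card, ?_, Finset.subset_univ _, rfl⟩
    have : S.card ≤ vcDim F := by
      refine le_csSup ⟨n, ?_⟩ ⟨S, (shatters_iff F S).2 (Finset.mem_shatterer.1 hS), rfl⟩
      rintro d ⟨T, -, rfl⟩
      simpa using Finset.card_le_univ T
    omega
  refine (Finset.card_le_card hsub).trans (Finset.card_biUnion_le.trans ?_)
  simp

lemma exVC_le (n k m : ℕ) (hn : 1 ≤ n) (hm : m = ∑ i ∈ Finset.range (k + 1), n.choose i) :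
    (exVC n k : ℝ) ≤ 2 ^ (n + 1) * (4 * n : ℝ) ^ m := by
  classical
  set E : Finset (Finset (Finset (Fin n))) :=
    Finset.univ.filter fun F => F.shatterer.card = F.card ∧ vcDim F ≤ k with hE
  have hcard : exVC n k = E.card := by
    unfold exVC
    simp only [card_sh]
    rw [Nat.card_eq_fintype_card, Fintype.card_subtype]
  set Ev : Finset (Fin n) → Finset (Finset (Finset (Fin n))) := fun v => E.filter (v ∈ ·) with hEv
  have hn' : (1 : ℝ) ≤ n := by exact_mod_cast hn
  have hv : ∀ v, ((Ev v).card : ℝ) ≤ (4 * n : ℝ) ^ m := by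
    intro v
    have h := count_conn (cubeNb (α := Fin n)) n m
      (fun a => by simpa [cubeNb] using
        (Finset.card_image_le (s := Finset.univ) (f := fun x : Fin n => symmDiff a {x})))
      v (Ev v) (by
        intro F hF
        simp only [hEv, hE, Finset.mem_filter, Finset.mem_univ, true_and] at hF
        obtain ⟨⟨h1, h2⟩, h3⟩ := hF
        exact ⟨h3, extremal_conn _ F rfl h1, by
          rw [hm, ← h1]; exact card_le_of_vcDim F h2⟩)
      (1 / (2 * n)) (by positivity) (by rw [div_le_one (by positivity)]; linarith)
    have hbern : (1 : ℝ) / 2 ≤ (1 - 1 / (2 * n)) ^ n := by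
      have := one_add_mul_le_pow (a := -(1 / (2 * n : ℝ))) (by
        have : (1 : ℝ) / (2 * n) ≤ 1 := by rw [div_le_one (by positivity)]; linarith
        linarith) n
      have e : (n : ℝ) * -(1 / (2 * n : ℝ)) = -(1/2) := by field_simp
      rw [e] at this
      rw [sub_eq_add_neg]
      linarith
    have hq : 1 / (4 * n : ℝ) ≤ 1 / (2 * n) * (1 - 1 / (2 * n)) ^ n := by
      calc 1 / (4 * n : ℝ) = 1 / (2 * n) * (1 / 2) := by field_simp; norm_num
        _ ≤ _ := by gcongr
    have h2 : ((Ev v).card : ℝ) * (1 / (4 * n : ℝ)) ^ m ≤ 1 :=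
      le_trans (by gcongr) h
    rw [one_div, inv_pow, ← div_eq_mul_inv, div_le_one (by positivity)] at h2
    exact h2
  have hsub : E ⊆ {∅} ∪ Finset.univ.biUnion Ev := by
    intro F hF
    rcases F.eq_empty_or_nonempty with rfl | ⟨v, hv⟩
    · simp
    · refine Finset.mem_union_right _ (Finset.mem_biUnion.2 ⟨v, Finset.mem_univ _, ?_⟩)
      exact Finset.mem_filter.2 ⟨hF, hv⟩
  have hc1 : E.card ≤ 1 + ∑ v, (Ev v).card :=
    (Finset.card_le_card hsub).trans ((Finset.card_union_le _ _).trans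
      (add_le_add (by simp) Finset.card_biUnion_le))
  have hM : (1 : ℝ) ≤ (4 * n : ℝ) ^ m := one_le_pow₀ (by linarith)
  have h2n : (1 : ℝ) ≤ 2 ^ n := one_le_pow₀ (by norm_num)
  calc (exVC n k : ℝ) ≤ 1 + ∑ v, ((Ev v).card : ℝ) := by rw [hcard]; exact_mod_cast hc1
    _ ≤ 1 + ∑ v : Finset (Fin n), (4 * n : ℝ) ^ m := by gcongr with v; exact hv v
    _ = 1 + 2 ^ n * (4 * n : ℝ) ^ m := by simp
    _ ≤ 2 ^ (n + 1) * (4 * n : ℝ) ^ m := by rw [pow_succ]; nlinarith [one_le_mul_of_one_le_of_one_le h2n hM]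

lemma sum_choose_le (n k : ℕ) (hk : k ≤ n) (δ : ℝ) (hδ : 0 ≤ δ)
    (h : (1 + δ) * k ≤ δ * (n - k)) : ∀ j ≤ k,
    (∑ i ∈ Finset.range (j + 1), (n.choose i : ℝ)) ≤ (1 + δ) * n.choose j := by
  intro j
  induction j with
  | zero => intro _; simp [hδ]
  | succ j ih =>
    intro hj
    have := ih (by omega)
    rw [Finset.sum_range_succ]
    have e : (n.choose (j+1) : ℝ) * (j + 1) = n.choose j * (n - j) := by
      have := Nat.choose_succ_right_eq n j
      have h2 : ((n - j : ℕ) : ℝ) = n - j := by rw [Nat.cast_sub (by omega)]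
      rw [← h2]; exact_mod_cast this
    have hjk : (j : ℝ) + 1 ≤ k := by exact_mod_cast hj
    have hkn : (k : ℝ) ≤ n := by exact_mod_cast hk
    have hpos : (0 : ℝ) < n - j := by linarith
    have c0 : (0 : ℝ) ≤ n.choose (j+1) := by positivity
    -- (1+δ) C(n,j) ≤ δ C(n,j+1)
    have : (1 + δ) * (n.choose j : ℝ) ≤ δ * n.choose (j+1) := by
      refine le_of_mul_le_mul_right ?_ hpos
      calc (1 + δ) * (n.choose j : ℝ) * (n - j) = n.choose (j+1) * ((1 + δ) * (j + 1)) := by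
            rw [mul_assoc, ← e]; ring
        _ ≤ n.choose (j+1) * (δ * (n - j)) := by
            refine mul_le_mul_of_nonneg_left ?_ c0
            calc (1 + δ) * ((j : ℝ) + 1) ≤ (1 + δ) * k := by gcongr
              _ ≤ δ * (n - k) := h
              _ ≤ δ * (n - j) := by gcongr; linarith
        _ = _ := by ring
    linarith

lemma le_choose_of (n k : ℕ) (hk : 1 ≤ k) (hkn : 2 * k ≤ n) : n ≤ n.choose k := by
  induction k, hk using Nat.le_induction with
  | base => simp
  | succ k hk ih =>
    exact (ih (by omega)).trans (Nat.choose_le_succ_of_lt_half_left (by omega))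

/-- If `k(n) = n^{o(1)}`, then `ExVC(n,k) ≤ n^{(1+o(1))·C(n,k)}`: for every `ε > 0`,
eventually the number of shattering-extremal families in the power set of `[n]` with
VC dimension at most `k(n)` is at most `n^{(1+ε)·C(n,k(n))}`. -/
theorem exVC_asymptotic_upper_bound (k : ℕ → ℕ) (hkpos : ∀ n, 0 < k n)
    (hko : Filter.Tendsto (fun n : ℕ => Real.log (k n) / Real.log n)
      Filter.atTop (nhds 0)) :
    ∀ ε : ℝ, 0 < ε → ∃ N : ℕ, ∀ n : ℕ, N ≤ n →
      (exVC n (k n) : ℝ) ≤ (n : ℝ) ^ ((1 + ε) * (n.choose (k n) : ℝ)) := by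
  intro ε hε
  set δ : ℝ := min (ε / 2) 1 with hδdef
  have hδ : 0 < δ := lt_min (by linarith) one_pos
  have hδ1 : δ ≤ 1 := min_le_right _ _
  have hδε : δ ≤ ε / 2 := min_le_left _ _
  have hcast : Filter.Tendsto (fun n : ℕ => (n : ℝ)) Filter.atTop Filter.atTop :=
    tendsto_natCast_atTop_atTop
  have hlog := Real.tendsto_log_atTop.comp hcast
  have e1 := hko.eventually (gt_mem_nhds (show (0 : ℝ) < 1 / 2 by norm_num))
  have e2 := hlog.eventually_ge_atTop (12 / ε + 1)
  have e3 := hcast.eventually_ge_atTop ((3 / δ) ^ 2 + 4)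
  obtain ⟨N, hN⟩ := Filter.eventually_atTop.1 ((e1.and e2).and e3)
  refine ⟨N, fun n hn => ?_⟩
  obtain ⟨⟨h1, h2⟩, h3⟩ := hN n hn
  simp only [Function.comp] at h2
  set L := Real.log n with hL
  have hεp : 0 < 12 / ε := by positivity
  have hLpos : 0 < L := by linarith
  have hn4 : (4 : ℝ) ≤ n := by nlinarith [sq_nonneg (3 / δ)]
  have hnpos : (0 : ℝ) < n := by linarith
  have hkp : (0 : ℝ) < k n := by exact_mod_cast hkpos n
  -- `k ≤ √n`
  have hksq : (k n : ℝ) ≤ Real.sqrt n := by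
    rw [div_lt_iff₀ hLpos] at h1
    rw [← Real.log_le_log_iff hkp (Real.sqrt_pos.2 hnpos), Real.log_sqrt hnpos.le]
    linarith
  set s := Real.sqrt n with hs
  have hss : s * s = n := Real.mul_self_sqrt hnpos.le
  have hs0 : 0 ≤ s := Real.sqrt_nonneg _
  have hs2 : 2 ≤ s := by nlinarith
  have hsδ : 3 / δ ≤ s := by
    rw [hs]; exact Real.le_sqrt_of_sq_le (by linarith)
  have h2k : 2 * k n ≤ n := by
    have : (2 * k n : ℝ) ≤ n := by nlinarith
    exact_mod_cast this
  have hratio : (1 + δ) * (k n : ℝ) ≤ δ * (n - k n) := by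
    have h3s : 3 ≤ s * δ := by rwa [div_le_iff₀ hδ] at hsδ
    nlinarith [mul_le_mul_of_nonneg_left h3s hs0]
  have hsum := sum_choose_le n (k n) (by omega) δ hδ.le hratio (k n) le_rfl
  have hnC : (n : ℝ) ≤ n.choose (k n) := by exact_mod_cast le_choose_of n (k n) (hkpos n) h2k
  set C : ℝ := (n.choose (k n) : ℝ) with hC
  set m : ℕ := ∑ i ∈ Finset.range (k n + 1), n.choose i with hm
  have hmC : (m : ℝ) ≤ (1 + δ) * C := by rw [hm]; push_cast; exact hsum
  have hn1 : 1 ≤ n := by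
    have : (1 : ℝ) ≤ n := by linarith
    exact_mod_cast this
  refine (exVC_le n (k n) m hn1 hm).trans ?_
  have hA : (0 : ℝ) < 2 ^ (n + 1) * (4 * n : ℝ) ^ m := by positivity
  rw [← Real.log_le_log_iff hA (Real.rpow_pos_of_pos hnpos _), Real.log_rpow hnpos,
    Real.log_mul (by positivity) (by positivity), Real.log_pow, Real.log_pow,
    Real.log_mul (by norm_num) hnpos.ne']
  have l2 : Real.log 2 ≤ 1 := by linarith [Real.log_two_lt_d9]
  have l20 : 0 ≤ Real.log 2 := Real.log_nonneg (by norm_num)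
  have l4 : Real.log 4 ≤ 2 := by
    rw [show (4 : ℝ) = 2 ^ 2 by norm_num, Real.log_pow]; push_cast; linarith
  have l40 : 0 ≤ Real.log 4 := Real.log_nonneg (by norm_num)
  have hC0 : 0 < C := by linarith
  have t1 : ((n + 1 : ℕ) : ℝ) * Real.log 2 ≤ 2 * C := by
    push_cast
    nlinarith
  have t2 : (m : ℝ) * (Real.log 4 + Real.log n) ≤ (1 + δ) * C * (2 + L) := by
    gcongr
  have t3 : 12 ≤ ε * L := by
    have : 12 / ε ≤ L := by linarith
    rwa [div_le_iff₀ hε, mul_comm] at this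
  have t4 : 2 + (1 + δ) * (2 + L) ≤ (1 + ε) * L := by nlinarith
  calc _ ≤ 2 * C + (1 + δ) * C * (2 + L) := add_le_add t1 t2
    _ = C * (2 + (1 + δ) * (2 + L)) := by ring
    _ ≤ C * ((1 + ε) * L) := by gcongr
    _ = _ := by rw [hL]; ring
end
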